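/- Let f ∈ ℝ[x,y,z] be a smooth psd ternary quartic. Then the Gram spectrahedron Gram(f) contains matrices of each of the ranks 3, 4 and 5, i.e., all ranks in the Pataki interval for ternary quartics are attained on Gram(f). -/

import Mathlib

open MvPolynomial Matrix

/-- The monomial basis `x², y², z², xy, xz, yz` of `ℝ[x,y,z]₂`. -/
noncomputable def gramBasis : Fin 6 → MvPolynomial (Fin 3) ℝ :=
  ![X 0 ^ 2, X 1 ^ 2, X 2 ^ 2, X 0 * X 1, X 0 * X 2, X 1 * X 2]

/-- The Gram spectrahedron of `f`: all real symmetric psd `6×6` matrices `G` with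
`Σᵢⱼ gᵢⱼ·mᵢ·mⱼ = f` for the monomial basis `m` of `ℝ[x,y,z]₂`. -/
noncomputable def GramSpectrahedron (f : MvPolynomial (Fin 3) ℝ) :
    Set (Matrix (Fin 6) (Fin 6) ℝ) :=
  {G | G.PosSemidef ∧
    (∑ i, ∑ j, MvPolynomial.C (G i j) * (gramBasis i * gramBasis j)) = f}

/-- `f` is smooth: no nonzero complex point at which all partial derivatives of the
complexification of `f` vanish. -/
def IsSmooth (f : MvPolynomial (Fin 3) ℝ) : Prop :=
  ∀ a : Fin 3 → ℂ,
    (∀ i, eval a (pderiv i (map (algebraMap ℝ ℂ) f)) = 0) → a = 0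

/-- `f` is positive semidefinite on `ℝ³`. -/
def IsPsd (f : MvPolynomial (Fin 3) ℝ) : Prop :=
  ∀ a : Fin 3 → ℝ, 0 ≤ eval a f


/-! ### Explicit forms in three variables -/

/-- value of a linear form -/
def e1 {K : Type*} [CommRing K] (m : Fin 3 → K) (x : Fin 3 → K) : K :=
  m 0 * x 0 + m 1 * x 1 + m 2 * x 2

/-- value of a quadratic form -/
def e2 {K : Type*} [CommRing K] (p : Fin 6 → K) (x : Fin 3 → K) : K :=
  p 0 * x 0 ^ 2 + p 1 * x 1 ^ 2 + p 2 * x 2 ^ 2 + p 3 * (x 0 * x 1) + p 4 * (x 0 * x 2)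
    + p 5 * (x 1 * x 2)

/-- value of a quartic form -/
def e4 {K : Type*} [CommRing K] (F : Fin 15 → K) (x : Fin 3 → K) : K :=
  F 0 * x 0 ^ 4 + F 1 * x 1 ^ 4 + F 2 * x 2 ^ 4
  + F 3 * (x 0 ^ 3 * x 1) + F 4 * (x 0 ^ 3 * x 2) + F 5 * (x 1 ^ 3 * x 0)
  + F 6 * (x 1 ^ 3 * x 2) + F 7 * (x 2 ^ 3 * x 0) + F 8 * (x 2 ^ 3 * x 1)
  + F 9 * (x 0 ^ 2 * x 1 ^ 2) + F 10 * (x 0 ^ 2 * x 2 ^ 2) + F 11 * (x 1 ^ 2 * x 2 ^ 2)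
  + F 12 * (x 0 ^ 2 * x 1 * x 2) + F 13 * (x 0 * x 1 ^ 2 * x 2) + F 14 * (x 0 * x 1 * x 2 ^ 2)

/-- linear times linear -/
def m11 {K : Type*} [CommRing K] (a b : Fin 3 → K) : Fin 6 → K :=
  ![a 0 * b 0, a 1 * b 1, a 2 * b 2, a 0 * b 1 + a 1 * b 0, a 0 * b 2 + a 2 * b 0,
    a 1 * b 2 + a 2 * b 1]

/-- linear times quadratic; monomials `x³,y³,z³,x²y,x²z,y²x,y²z,z²x,z²y,xyz` -/
def m12 {K : Type*} [CommRing K] (a : Fin 3 → K) (p : Fin 6 → K) : Fin 10 → K :=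
  ![a 0 * p 0, a 1 * p 1, a 2 * p 2,
    a 0 * p 3 + a 1 * p 0, a 0 * p 4 + a 2 * p 0,
    a 1 * p 3 + a 0 * p 1, a 1 * p 5 + a 2 * p 1,
    a 2 * p 4 + a 0 * p 2, a 2 * p 5 + a 1 * p 2,
    a 0 * p 5 + a 1 * p 4 + a 2 * p 3]

/-- linear times cubic -/
def m13 {K : Type*} [CommRing K] (a : Fin 3 → K) (c : Fin 10 → K) : Fin 15 → K :=
  ![a 0 * c 0, a 1 * c 1, a 2 * c 2,
    a 0 * c 3 + a 1 * c 0, a 0 * c 4 + a 2 * c 0,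
    a 1 * c 5 + a 0 * c 1, a 1 * c 6 + a 2 * c 1,
    a 2 * c 7 + a 0 * c 2, a 2 * c 8 + a 1 * c 2,
    a 0 * c 5 + a 1 * c 3, a 0 * c 7 + a 2 * c 4, a 1 * c 8 + a 2 * c 6,
    a 0 * c 9 + a 1 * c 4 + a 2 * c 3, a 1 * c 9 + a 0 * c 6 + a 2 * c 5,
    a 2 * c 9 + a 0 * c 8 + a 1 * c 7]

/-- quadratic times quadratic -/
def m22 {K : Type*} [CommRing K] (p q : Fin 6 → K) : Fin 15 → K :=
  ![p 0 * q 0, p 1 * q 1, p 2 * q 2,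
    p 0 * q 3 + p 3 * q 0, p 0 * q 4 + p 4 * q 0,
    p 1 * q 3 + p 3 * q 1, p 1 * q 5 + p 5 * q 1,
    p 2 * q 4 + p 4 * q 2, p 2 * q 5 + p 5 * q 2,
    p 0 * q 1 + p 1 * q 0 + p 3 * q 3, p 0 * q 2 + p 2 * q 0 + p 4 * q 4,
    p 1 * q 2 + p 2 * q 1 + p 5 * q 5,
    p 0 * q 5 + p 5 * q 0 + p 3 * q 4 + p 4 * q 3,
    p 1 * q 4 + p 4 * q 1 + p 3 * q 5 + p 5 * q 3,
    p 2 * q 3 + p 3 * q 2 + p 4 * q 5 + p 5 * q 4]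

lemma e2_m11 {K : Type*} [CommRing K] (a b x : Fin 3 → K) :
    e2 (m11 a b) x = e1 a x * e1 b x := by
  simp [e2, m11, e1]; ring

lemma e4_m22 {K : Type*} [CommRing K] (p q : Fin 6 → K) (x : Fin 3 → K) :
    e4 (m22 p q) x = e2 p x * e2 q x := by
  simp [e4, m22, e2]; ring

lemma m13_m12 {K : Type*} [CommRing K] (a b : Fin 3 → K) (p : Fin 6 → K) :
    m13 a (m12 b p) = m22 p (m11 a b) := by
  ext i; fin_cases i <;> simp [m13, m12, m22, m11] <;> ring

/-! ### Common zeros over `ℂ` -/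

lemma binary_quartic_zero (c0 c1 c2 c3 c4 : ℂ) : ∃ x y : ℂ, (x ≠ 0 ∨ y ≠ 0) ∧
    c0 * x ^ 4 + c1 * x ^ 3 * y + c2 * x ^ 2 * y ^ 2 + c3 * x * y ^ 3 + c4 * y ^ 4 = 0 := by
  by_cases h : c0 = 0
  · exact ⟨1, 0, by simp, by simp [h]⟩
  · open Polynomial in
    have hd : (Polynomial.C c0 * Polynomial.X ^ 4 + Polynomial.C c1 * Polynomial.X ^ 3 + Polynomial.C c2 * Polynomial.X ^ 2 + Polynomial.C c3 * Polynomial.X + Polynomial.C c4 : ℂ[X]).degree = 4 := by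
      compute_degree!
    obtain ⟨x, hx⟩ := IsAlgClosed.exists_root _ (by rw [hd]; norm_num)
    refine ⟨x, 1, by simp, ?_⟩
    simpa [Polynomial.IsRoot] using hx

lemma quadratic_zero (a b c : ℂ) (ha : a ≠ 0) : ∃ z : ℂ, a * z ^ 2 + b * z + c = 0 := by
  open Polynomial in
  have hd : (Polynomial.C a * Polynomial.X ^ 2 + Polynomial.C b * Polynomial.X + Polynomial.C c : ℂ[X]).degree = 2 := by
    compute_degree!
  obtain ⟨x, hx⟩ := IsAlgClosed.exists_root _ (by rw [hd]; norm_num)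
  refine ⟨x, ?_⟩
  simpa [Polynomial.IsRoot] using hx

lemma two_conics_aux (p q : Fin 6 → ℂ) (hp : p 2 ≠ 0) :
    ∃ a : Fin 3 → ℂ, a ≠ 0 ∧ e2 p a = 0 ∧ e2 q a = 0 := by
  -- `s = q - (q₂/p₂) p` has no `z²` term
  obtain ⟨s, hs2, hs⟩ : ∃ s : Fin 6 → ℂ, s 2 = 0 ∧
      ∀ x, e2 q x = q 2 / p 2 * e2 p x + e2 s x := by
    refine ⟨fun i => q i - q 2 / p 2 * p i, by field_simp; simp, fun x => ?_⟩
    simp only [e2]; ring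
  suffices ∃ a : Fin 3 → ℂ, a ≠ 0 ∧ e2 p a = 0 ∧ e2 s a = 0 by
    obtain ⟨a, h0, h1, h2⟩ := this
    exact ⟨a, h0, h1, by rw [hs, h1, h2]; simp⟩
  -- eliminate `z`
  obtain ⟨x, y, hxy, h⟩ := binary_quartic_zero
    (p 2 * s 0 ^ 2 - p 4 * s 4 * s 0 + p 0 * s 4 ^ 2)
    (2 * p 2 * s 0 * s 3 - p 4 * s 4 * s 3 - p 4 * s 5 * s 0 - p 5 * s 4 * s 0
      + 2 * p 0 * s 4 * s 5 + p 3 * s 4 ^ 2)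
    (p 2 * s 3 ^ 2 + 2 * p 2 * s 0 * s 1 - p 4 * s 4 * s 1 - p 4 * s 5 * s 3 - p 5 * s 4 * s 3
      - p 5 * s 5 * s 0 + p 0 * s 5 ^ 2 + 2 * p 3 * s 4 * s 5 + p 1 * s 4 ^ 2)
    (2 * p 2 * s 1 * s 3 - p 4 * s 5 * s 1 - p 5 * s 4 * s 1 - p 5 * s 5 * s 3
      + p 3 * s 5 ^ 2 + 2 * p 1 * s 4 * s 5)
    (p 2 * s 1 ^ 2 - p 5 * s 5 * s 1 + p 1 * s 5 ^ 2)
  set b := s 4 * x + s 5 * y with hb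
  set c := s 0 * x ^ 2 + s 3 * x * y + s 1 * y ^ 2 with hc
  have hel : p 2 * c ^ 2 - (p 4 * x + p 5 * y) * b * c
      + (p 0 * x ^ 2 + p 3 * x * y + p 1 * y ^ 2) * b ^ 2 = 0 := by
    rw [← h, hb, hc]; ring
  have hne : ∀ z : ℂ, (![x, y, z] : Fin 3 → ℂ) ≠ 0 := by
    intro z hz
    have h0 := congrFun hz 0
    have h1 := congrFun hz 1
    simp at h0 h1
    rcases hxy with h | h <;> contradiction
  by_cases hb0 : b = 0
  · have hc0 : c = 0 := by
      rw [hb0] at hel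
      simpa [hp] using hel
    obtain ⟨z, hz⟩ := quadratic_zero (p 2) (p 4 * x + p 5 * y)
      (p 0 * x ^ 2 + p 3 * x * y + p 1 * y ^ 2) hp
    refine ⟨![x, y, z], hne z, ?_, ?_⟩
    · simp [e2]; linear_combination hz
    · simp [e2, hs2]; linear_combination z * (hb.symm.trans hb0) + (hc.symm.trans hc0)
  · refine ⟨![x, y, -c / b], hne _, ?_, ?_⟩
    · simp [e2]; field_simp; linear_combination hel
    · simp [e2, hs2]; field_simp; linear_combination (-c) * hb + b * (-hc)

lemma two_conics (p q : Fin 6 → ℂ) :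
    ∃ a : Fin 3 → ℂ, a ≠ 0 ∧ e2 p a = 0 ∧ e2 q a = 0 := by
  by_cases hp : p 2 = 0
  · by_cases hq : q 2 = 0
    · refine ⟨![0, 0, 1], ?_, by simp [e2, hp], by simp [e2, hq]⟩
      intro h; simpa using congrFun h 2
    · obtain ⟨a, h0, h1, h2⟩ := two_conics_aux q p hq
      exact ⟨a, h0, h2, h1⟩
  · exact two_conics_aux p q hp


set_option linter.unusedSimpArgs false

/-- value of a cubic form -/
def e3 {K : Type*} [CommRing K] (c : Fin 10 → K) (x : Fin 3 → K) : K :=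
  c 0 * x 0 ^ 3 + c 1 * x 1 ^ 3 + c 2 * x 2 ^ 3 + c 3 * (x 0 ^ 2 * x 1) + c 4 * (x 0 ^ 2 * x 2)
  + c 5 * (x 1 ^ 2 * x 0) + c 6 * (x 1 ^ 2 * x 2) + c 7 * (x 2 ^ 2 * x 0) + c 8 * (x 2 ^ 2 * x 1)
  + c 9 * (x 0 * x 1 * x 2)

lemma e3_m12 {K : Type*} [CommRing K] (a : Fin 3 → K) (p : Fin 6 → K) (x : Fin 3 → K) :
    e3 (m12 a p) x = e1 a x * e2 p x := by
  simp [e3, m12, e1, e2]; ring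

lemma e3_eq_zero (c : Fin 10 → ℂ) (h : ∀ x, e3 c x = 0) : ∀ i, c i = 0 := by
  have h0 : c 0 = 0 := by simpa [e3] using h ![1, 0, 0]
  have h1 : c 1 = 0 := by simpa [e3] using h ![0, 1, 0]
  have h2 : c 2 = 0 := by simpa [e3] using h ![0, 0, 1]
  have a1 : c 3 + c 5 = 0 := by simpa [e3, h0, h1, h2] using h ![1, 1, 0]
  have a2 : -c 3 + c 5 = 0 := by simpa [e3, h0, h1, h2] using h ![1, -1, 0]
  have b1 : c 4 + c 7 = 0 := by simpa [e3, h0, h1, h2] using h ![1, 0, 1]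
  have b2 : -c 4 + c 7 = 0 := by simpa [e3, h0, h1, h2] using h ![1, 0, -1]
  have d1 : c 6 + c 8 = 0 := by simpa [e3, h0, h1, h2] using h ![0, 1, 1]
  have d2 : -c 6 + c 8 = 0 := by simpa [e3, h0, h1, h2] using h ![0, 1, -1]
  have h3 : c 3 = 0 := by linear_combination a1 / 2 - a2 / 2
  have h5 : c 5 = 0 := by linear_combination a1 / 2 + a2 / 2
  have h4 : c 4 = 0 := by linear_combination b1 / 2 - b2 / 2
  have h7 : c 7 = 0 := by linear_combination b1 / 2 + b2 / 2
  have h6 : c 6 = 0 := by linear_combination d1 / 2 - d2 / 2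
  have h8 : c 8 = 0 := by linear_combination d1 / 2 + d2 / 2
  have h9 : c 9 = 0 := by simpa [e3, h0, h1, h2, h3, h4, h5, h6, h7, h8] using h ![1, 1, 1]
  intro i; fin_cases i <;> assumption

/-- a matrix has an eigenvector -/
lemma exists_eigvec (A : Matrix (Fin 3) (Fin 3) ℂ) :
    ∃ (a : Fin 3 → ℂ) (μ : ℂ), a ≠ 0 ∧ A *ᵥ a = μ • a := by
  obtain ⟨μ, hμ⟩ := Module.End.exists_eigenvalue (Matrix.toLin' A)
  obtain ⟨a, ha⟩ := hμ.exists_hasEigenvector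
  exact ⟨a, μ, ha.2, by simpa using ha.apply_eq_smul⟩

lemma line_conic (m : Fin 3 → ℂ) (q : Fin 6 → ℂ) :
    ∃ a : Fin 3 → ℂ, a ≠ 0 ∧ e1 m a = 0 ∧ e2 q a = 0 := by
  obtain ⟨a, h0, h1, h2⟩ := two_conics (m11 m m) q
  rw [e2_m11] at h1
  exact ⟨a, h0, by simpa using h1, h2⟩

lemma diag_syzygy (Q : Fin 3 → Fin 6 → ℂ) (d : Fin 3 → ℂ) (hd : d ≠ 0)
    (h : ∀ x : Fin 3 → ℂ, d 0 * x 0 * e2 (Q 0) x + d 1 * x 1 * e2 (Q 1) x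
      + d 2 * x 2 * e2 (Q 2) x = 0) :
    ∃ a : Fin 3 → ℂ, a ≠ 0 ∧ e2 (Q 0) a = 0 ∧ e2 (Q 1) a = 0 ∧ e2 (Q 2) a = 0 := by
  have hc := e3_eq_zero (m12 ![d 0, 0, 0] (Q 0) + m12 ![0, d 1, 0] (Q 1) + m12 ![0, 0, d 2] (Q 2))
    (by
      intro x
      have : e3 (m12 ![d 0, 0, 0] (Q 0) + m12 ![0, d 1, 0] (Q 1) + m12 ![0, 0, d 2] (Q 2)) x
        = e3 (m12 ![d 0, 0, 0] (Q 0)) x + e3 (m12 ![0, d 1, 0] (Q 1)) x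
          + e3 (m12 ![0, 0, d 2] (Q 2)) x := by
        simp only [e3, Pi.add_apply]; ring
      rw [this, e3_m12, e3_m12, e3_m12]
      refine Eq.trans ?_ (h x)
      simp [e1])
  have c0 := hc 0
  have c1 := hc 1
  have c2 := hc 2
  have c3 := hc 3
  have c4 := hc 4
  have c5 := hc 5
  have c6 := hc 6
  have c7 := hc 7
  have c8 := hc 8
  have c9 := hc 9
  simp [m12] at c0 c1 c2 c3 c4 c5 c6 c7 c8 c9
  clear hc h
  by_cases d0 : d 0 = 0 <;> by_cases d1 : d 1 = 0 <;> by_cases d2 : d 2 = 0 <;>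
    simp [d0, d1, d2] at c0 c1 c2 c3 c4 c5 c6 c7 c8 c9
  · exact absurd (by ext i; fin_cases i <;> simpa) hd
  · obtain ⟨a, h0, h1, h2⟩ := two_conics (Q 0) (Q 1)
    exact ⟨a, h0, h1, h2, by simp [e2, *]⟩
  · obtain ⟨a, h0, h1, h2⟩ := two_conics (Q 0) (Q 2)
    exact ⟨a, h0, h1, by simp [e2, *], h2⟩
  · obtain ⟨a, h0, h1, h2⟩ := line_conic ![Q 1 4, Q 1 5, Q 1 2] (Q 0)
    simp [e1] at h1
    refine ⟨a, h0, h2, ?_, ?_⟩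
    · simp [e2, *]; linear_combination a 2 * h1
    · apply mul_left_cancel₀ d2; simp only [e2, mul_zero, zero_mul, add_zero, zero_add, c1, c2, c3, c4, c5, c7]
      linear_combination (-d 1 * a 1) * h1 + a 1 * a 2 * c8 + a 1 ^ 2 * c6 + a 0 * a 1 * c9
  · obtain ⟨a, h0, h1, h2⟩ := two_conics (Q 1) (Q 2)
    exact ⟨a, h0, by simp [e2, *], h1, h2⟩
  · obtain ⟨a, h0, h1, h2⟩ := line_conic ![Q 0 4, Q 0 5, Q 0 2] (Q 1)
    simp [e1] at h1
    refine ⟨a, h0, ?_, h2, ?_⟩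
    · simp [e2, *]; linear_combination a 2 * h1
    · apply mul_left_cancel₀ d2; simp only [e2, mul_zero, zero_mul, add_zero, zero_add, c0, c2, c3, c5, c6, c8]
      linear_combination (-d 0 * a 0) * h1 + a 0 * a 2 * c7 + a 0 ^ 2 * c4 + a 0 * a 1 * c9
  · obtain ⟨a, h0, h1, h2⟩ := line_conic ![Q 0 3, Q 0 1, Q 0 5] (Q 2)
    simp [e1] at h1
    refine ⟨a, h0, ?_, ?_, h2⟩
    · simp [e2, *]; linear_combination a 1 * h1
    · apply mul_left_cancel₀ d1; simp only [e2, mul_zero, zero_mul, add_zero, zero_add, c0, c1, c4, c6, c7, c8]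
      linear_combination (-d 0 * a 0) * h1 + a 0 * a 1 * c5 + a 0 ^ 2 * c3 + a 0 * a 2 * c9
  · obtain ⟨a, μ, ha, hA⟩ := exists_eigvec
      !![d 1 * Q 1 4, d 1 * Q 1 5, d 1 * Q 1 2;
         d 2 * Q 2 0, - (d 0 * Q 0 5), d 2 * Q 2 4;
         d 0 * Q 0 3, d 0 * Q 0 1, 0]
    have g0 := congrFun hA 0
    have g1 := congrFun hA 1
    have g2 := congrFun hA 2
    simp [Matrix.mulVec, dotProduct, Fin.sum_univ_three] at g0 g1 g2
    refine ⟨a, ha, ?_, ?_, ?_⟩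
    · apply mul_left_cancel₀ d0; simp only [e2, mul_zero, zero_mul, add_zero, zero_add, c0]
      linear_combination a 1 * g2 - a 2 * g1 + a 0 * a 2 * c4 + a 2 ^ 2 * c7
    · apply mul_left_cancel₀ d1; simp only [e2, mul_zero, zero_mul, add_zero, zero_add, c1]
      linear_combination a 2 * g0 - a 0 * g2 + a 0 ^ 2 * c3 + a 0 * a 1 * c5
    · apply mul_left_cancel₀ d2; simp only [e2, mul_zero, zero_mul, add_zero, zero_add, c2]
      linear_combination a 0 * g1 - a 1 * g0 + a 1 ^ 2 * c6 + a 1 * a 2 * c8 + a 0 * a 1 * c9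

/-- substitution of a linear map into a quadratic form -/
lemma e2_comp (p : Fin 6 → ℂ) (T : Matrix (Fin 3) (Fin 3) ℂ) :
    ∃ p' : Fin 6 → ℂ, ∀ x, e2 p' x = e2 p (T *ᵥ x) := by
  refine ⟨p 0 • m11 (T 0) (T 0) + p 1 • m11 (T 1) (T 1) + p 2 • m11 (T 2) (T 2)
    + p 3 • m11 (T 0) (T 1) + p 4 • m11 (T 0) (T 2) + p 5 • m11 (T 1) (T 2), fun x => ?_⟩
  simp [e2, m11, Matrix.mulVec, dotProduct, Fin.sum_univ_three]
  ring

lemma e2_sum (c : Fin 3 → ℂ) (Q : Fin 3 → Fin 6 → ℂ) (x : Fin 3 → ℂ) :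
    e2 (∑ i, c i • Q i) x = ∑ i, c i * e2 (Q i) x := by
  simp [e2, Fin.sum_univ_three]; ring

lemma linear_syzygy (Q : Fin 3 → Fin 6 → ℂ) (M : Matrix (Fin 3) (Fin 3) ℂ) (hM : M ≠ 0)
    (h : ∀ x : Fin 3 → ℂ, (M *ᵥ x) ⬝ᵥ (fun i => e2 (Q i) x) = 0) :
    ∃ a : Fin 3 → ℂ, a ≠ 0 ∧ ∀ i, e2 (Q i) a = 0 := by
  obtain ⟨L, L', D, hD⟩ := Matrix.Pivot.exists_list_transvec_mul_mul_list_transvec_eq_diagonal M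
  set A := (L.map Matrix.TransvectionStruct.toMatrix).prod with hA
  set B := (L'.map Matrix.TransvectionStruct.toMatrix).prod with hB
  have hAu : IsUnit A.det := by rw [hA, Matrix.TransvectionStruct.det_toMatrix_prod]; simp
  have hBu : IsUnit B.det := by rw [hB, Matrix.TransvectionStruct.det_toMatrix_prod]; simp
  have hAi : A⁻¹ * A = 1 := Matrix.nonsing_inv_mul _ hAu
  have hAi' : A * A⁻¹ = 1 := Matrix.mul_nonsing_inv _ hAu
  have hBi : B * B⁻¹ = 1 := Matrix.mul_nonsing_inv _ hBu
  have hBi' : B⁻¹ * B = 1 := Matrix.nonsing_inv_mul _ hBu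
  have hMD : M = A⁻¹ * Matrix.diagonal D * B⁻¹ := by
    rw [← hD]
    calc M = (A⁻¹ * A) * M * (B * B⁻¹) := by rw [hAi, hBi]; simp
      _ = _ := by simp only [Matrix.mul_assoc]
  choose Q' hQ' using fun i => e2_comp (Q i) B
  -- new triple
  have key := diag_syzygy (fun j => ∑ i, A⁻¹ i j • Q' i) D
    (by rintro rfl; apply hM; rw [hMD]; simp)
    (by
      intro y
      have h1 := h (B *ᵥ y)
      rw [hMD, Matrix.mulVec_mulVec, Matrix.mul_assoc, hBi', Matrix.mul_one,
        ← Matrix.mulVec_mulVec] at h1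
      rw [← h1]
      obtain ⟨E, hE⟩ : ∃ E : Fin 3 → ℂ, ∀ i, e2 (Q i) (B *ᵥ y) = E i := ⟨_, fun _ => rfl⟩
      simp only [e2_sum, hQ', hE]
      simp [Matrix.mulVec, dotProduct, Fin.sum_univ_three, Matrix.diagonal_apply]
      ring)
  obtain ⟨a, ha, h0, h1, h2⟩ := key
  refine ⟨B *ᵥ a, fun hz => ha ?_, ?_⟩
  · have := congrArg (fun v => B⁻¹ *ᵥ v) hz
    simpa [Matrix.mulVec_mulVec, hBi'] using this
  · have hz : A⁻¹ᵀ *ᵥ (fun i => e2 (Q i) (B *ᵥ a)) = 0 := by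
      ext j
      have : ∀ j, e2 (∑ i, A⁻¹ i j • Q' i) a = 0 := by
        intro j; fin_cases j <;> assumption
      refine Eq.trans ?_ (this j)
      rw [e2_sum]
      simp [Matrix.mulVec, dotProduct, hQ']
    have := congrArg (fun v => Aᵀ *ᵥ v) hz
    have hT : Aᵀ * A⁻¹ᵀ = 1 := by rw [← Matrix.transpose_mul, hAi, Matrix.transpose_one]
    rw [Matrix.mulVec_mulVec, hT] at this
    intro i
    simpa using congrFun this i

set_option linter.unusedSimpArgs false
/-! ### Base point free triples of real conics -/

/-- complexification of a coefficient vector -/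
def toC {n : ℕ} (p : Fin n → ℝ) : Fin n → ℂ := fun i => (p i : ℂ)

/-- no common complex zero -/
def BPF (p : Fin 3 → Fin 6 → ℝ) : Prop :=
  ∀ a : Fin 3 → ℂ, (∀ i, e2 (toC (p i)) a = 0) → a = 0

lemma toC_m12 (m : Fin 3 → ℝ) (p : Fin 6 → ℝ) : toC (m12 m p) = m12 (toC m) (toC p) := by
  ext i; fin_cases i <;> simp [toC, m12]

lemma BPF.syzygy {p : Fin 3 → Fin 6 → ℝ} (hp : BPF p) (m : Fin 3 → Fin 3 → ℝ)
    (h : ∑ i, m12 (m i) (p i) = 0) : m = 0 := by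
  by_contra hm
  have hM : (Matrix.of fun i j => (m i j : ℂ)) ≠ 0 := by
    intro h0
    apply hm
    ext i j
    have := congrFun (congrFun h0 i) j
    simpa using this
  obtain ⟨a, ha, h0⟩ := linear_syzygy (fun i => toC (p i)) _ hM (by
    intro x
    have h1 : e3 (toC (∑ i, m12 (m i) (p i))) x = 0 := by
      rw [h]; simp [e3, toC]
    have h2 : e3 (toC (∑ i, m12 (m i) (p i))) x = ∑ i, e3 (toC (m12 (m i) (p i))) x := by
      simp [e3, toC, Fin.sum_univ_three]; ring
    rw [h2] at h1
    simp only [toC_m12, e3_m12] at h1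
    rw [← h1]
    simp [Matrix.mulVec, dotProduct, Fin.sum_univ_three, e1, toC])
  exact ha (hp a h0)

lemma BPF.linearIndependent {p : Fin 3 → Fin 6 → ℝ} (hp : BPF p) : LinearIndependent ℝ p := by
  rw [Fintype.linearIndependent_iff]
  intro g hg i
  have h := hp.syzygy (fun i => ![g i, 0, 0]) (by
    have h1 : ∑ i, m12 (![g i, 0, 0] : Fin 3 → ℝ) (p i) = m12 ![1, 0, 0] (∑ i, g i • p i) := by
      ext k; fin_cases k <;> simp [m12, Fin.sum_univ_three]
    rw [h1, hg]
    ext k; fin_cases k <;> simp [m12])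
  simpa using congrFun (congrFun h i) 0


lemma m22_add_left (a b : Fin 6 → ℝ) (c : Fin 6 → ℝ) : m22 (a + b) c = m22 a c + m22 b c := by
  simp only [m22, Pi.add_apply, Matrix.cons_add_cons, Matrix.empty_add_empty]; ring_nf
lemma m22_smul_left (t : ℝ) (a : Fin 6 → ℝ) (c : Fin 6 → ℝ) : m22 (t • a) c = t • m22 a c := by
  simp only [m22, Pi.smul_apply, smul_eq_mul, Matrix.smul_cons, Matrix.smul_empty]; ring_nf
lemma m22_add_right (a : Fin 6 → ℝ) (b c : Fin 6 → ℝ) : m22 a (b + c) = m22 a b + m22 a c := by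
  simp only [m22, Pi.add_apply, Matrix.cons_add_cons, Matrix.empty_add_empty]; ring_nf
lemma m22_smul_right (t : ℝ) (a : Fin 6 → ℝ) (c : Fin 6 → ℝ) : m22 a (t • c) = t • m22 a c := by
  simp only [m22, Pi.smul_apply, smul_eq_mul, Matrix.smul_cons, Matrix.smul_empty]; ring_nf

lemma m12_add_left (a b : Fin 3 → ℝ) (c : Fin 6 → ℝ) : m12 (a + b) c = m12 a c + m12 b c := by
  simp only [m12, Pi.add_apply, Matrix.cons_add_cons, Matrix.empty_add_empty]; ring_nf
lemma m12_smul_left (t : ℝ) (a : Fin 3 → ℝ) (c : Fin 6 → ℝ) : m12 (t • a) c = t • m12 a c := by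
  simp only [m12, Pi.smul_apply, smul_eq_mul, Matrix.smul_cons, Matrix.smul_empty]; ring_nf
lemma m12_add_right (a : Fin 3 → ℝ) (b c : Fin 6 → ℝ) : m12 a (b + c) = m12 a b + m12 a c := by
  simp only [m12, Pi.add_apply, Matrix.cons_add_cons, Matrix.empty_add_empty]; ring_nf
lemma m12_smul_right (t : ℝ) (a : Fin 3 → ℝ) (c : Fin 6 → ℝ) : m12 a (t • c) = t • m12 a c := by
  simp only [m12, Pi.smul_apply, smul_eq_mul, Matrix.smul_cons, Matrix.smul_empty]; ring_nf

lemma m13_add_left (a b : Fin 3 → ℝ) (c : Fin 10 → ℝ) : m13 (a + b) c = m13 a c + m13 b c := by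
  simp only [m13, Pi.add_apply, Matrix.cons_add_cons, Matrix.empty_add_empty]; ring_nf
lemma m13_smul_left (t : ℝ) (a : Fin 3 → ℝ) (c : Fin 10 → ℝ) : m13 (t • a) c = t • m13 a c := by
  simp only [m13, Pi.smul_apply, smul_eq_mul, Matrix.smul_cons, Matrix.smul_empty]; ring_nf
lemma m13_add_right (a : Fin 3 → ℝ) (b c : Fin 10 → ℝ) : m13 a (b + c) = m13 a b + m13 a c := by
  simp only [m13, Pi.add_apply, Matrix.cons_add_cons, Matrix.empty_add_empty]; ring_nf
lemma m13_smul_right (t : ℝ) (a : Fin 3 → ℝ) (c : Fin 10 → ℝ) : m13 a (t • c) = t • m13 a c := by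
  simp only [m13, Pi.smul_apply, smul_eq_mul, Matrix.smul_cons, Matrix.smul_empty]; ring_nf

/-- `m22` as a bilinear map -/
noncomputable def m22L : (Fin 6 → ℝ) →ₗ[ℝ] (Fin 6 → ℝ) →ₗ[ℝ] (Fin 15 → ℝ) :=
  LinearMap.mk₂ ℝ m22 m22_add_left m22_smul_left m22_add_right
    (fun t a c => m22_smul_right t a c)

/-- `m12` as a bilinear map -/
noncomputable def m12L : (Fin 3 → ℝ) →ₗ[ℝ] (Fin 6 → ℝ) →ₗ[ℝ] (Fin 10 → ℝ) :=
  LinearMap.mk₂ ℝ m12 m12_add_left m12_smul_left m12_add_right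
    (fun t a c => m12_smul_right t a c)

/-- `m13` as a bilinear map -/
noncomputable def m13L : (Fin 3 → ℝ) →ₗ[ℝ] (Fin 10 → ℝ) →ₗ[ℝ] (Fin 15 → ℝ) :=
  LinearMap.mk₂ ℝ m13 m13_add_left m13_smul_left m13_add_right
    (fun t a c => m13_smul_right t a c)

@[simp] lemma m22L_apply (p q : Fin 6 → ℝ) : m22L p q = m22 p q := rfl
@[simp] lemma m12L_apply (p : Fin 3 → ℝ) (q : Fin 6 → ℝ) : m12L p q = m12 p q := rfl
@[simp] lemma m13L_apply (p : Fin 3 → ℝ) (q : Fin 10 → ℝ) : m13L p q = m13 p q := rfl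

/-- `u ↦ ∑ pᵢ uᵢ` -/
noncomputable def dmap (p : Fin 3 → Fin 6 → ℝ) : (Fin 3 → Fin 6 → ℝ) →ₗ[ℝ] (Fin 15 → ℝ) :=
  ∑ i, (m22L (p i)).comp (LinearMap.proj i)

/-- `m ↦ ∑ mᵢ pᵢ` with linear coefficients -/
noncomputable def lmap (p : Fin 3 → Fin 6 → ℝ) : (Fin 3 → Fin 3 → ℝ) →ₗ[ℝ] (Fin 10 → ℝ) :=
  ∑ i, (m12L.flip (p i)).comp (LinearMap.proj i)

lemma dmap_apply (p u : Fin 3 → Fin 6 → ℝ) : dmap p u = ∑ i, m22 (p i) (u i) := by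
  simp [dmap]

lemma lmap_apply (p : Fin 3 → Fin 6 → ℝ) (m : Fin 3 → Fin 3 → ℝ) :
    lmap p m = ∑ i, m12 (m i) (p i) := by
  simp [lmap]

/-- coordinate linear form -/
def xx (i : Fin 3) : Fin 3 → ℝ := Pi.single i 1

lemma m12_comm (a b c : Fin 3 → ℝ) : m12 a (m11 b c) = m12 b (m11 a c) := by
  ext i; fin_cases i <;> simp [m12, m11] <;> ring
lemma m11_comm (a b : Fin 3 → ℝ) : m11 a b = m11 b a := by
  ext i; fin_cases i <;> simp [m11] <;> ring
lemma m13_comm (a b : Fin 3 → ℝ) (p : Fin 6 → ℝ) : m13 a (m12 b p) = m13 b (m12 a p) := by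
  rw [m13_m12, m13_m12, m11_comm]

/-- every quartic is a combination of monomials -/
lemma quartic_span (L : (Fin 15 → ℝ) →ₗ[ℝ] ℝ)
    (h : ∀ i j k l, L (m13 (xx i) (m12 (xx j) (m11 (xx k) (xx l)))) = 0) : L = 0 := by
  have key : ∀ n : Fin 15, ∃ i j k l : Fin 3,
      (Pi.single n 1 : Fin 15 → ℝ) = m13 (xx i) (m12 (xx j) (m11 (xx k) (xx l))) := by
    intro n
    fin_cases n
    · exact ⟨0, 0, 0, 0, by ext t; fin_cases t <;> simp [m13, m12, m11, xx]⟩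
    · exact ⟨1, 1, 1, 1, by ext t; fin_cases t <;> simp [m13, m12, m11, xx]⟩
    · exact ⟨2, 2, 2, 2, by ext t; fin_cases t <;> simp [m13, m12, m11, xx]⟩
    · exact ⟨0, 0, 0, 1, by ext t; fin_cases t <;> simp [m13, m12, m11, xx]⟩
    · exact ⟨0, 0, 0, 2, by ext t; fin_cases t <;> simp [m13, m12, m11, xx]⟩
    · exact ⟨1, 1, 1, 0, by ext t; fin_cases t <;> simp [m13, m12, m11, xx]⟩
    · exact ⟨1, 1, 1, 2, by ext t; fin_cases t <;> simp [m13, m12, m11, xx]⟩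
    · exact ⟨2, 2, 2, 0, by ext t; fin_cases t <;> simp [m13, m12, m11, xx]⟩
    · exact ⟨2, 2, 2, 1, by ext t; fin_cases t <;> simp [m13, m12, m11, xx]⟩
    · exact ⟨0, 0, 1, 1, by ext t; fin_cases t <;> simp [m13, m12, m11, xx]⟩
    · exact ⟨0, 0, 2, 2, by ext t; fin_cases t <;> simp [m13, m12, m11, xx]⟩
    · exact ⟨1, 1, 2, 2, by ext t; fin_cases t <;> simp [m13, m12, m11, xx]⟩
    · exact ⟨0, 0, 1, 2, by ext t; fin_cases t <;> simp [m13, m12, m11, xx]⟩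
    · exact ⟨0, 1, 1, 2, by ext t; fin_cases t <;> simp [m13, m12, m11, xx]⟩
    · exact ⟨0, 1, 2, 2, by ext t; fin_cases t <;> simp [m13, m12, m11, xx]⟩
  refine LinearMap.pi_ext' fun n => LinearMap.ext_ring ?_
  obtain ⟨i, j, k, l, e⟩ := key n
  simp only [LinearMap.comp_apply, LinearMap.single_apply]
  rw [e, h]; simp

lemma BPF.no_functional {p : Fin 3 → Fin 6 → ℝ} (hp : BPF p) (L : (Fin 15 → ℝ) →ₗ[ℝ] ℝ)
    (hL : ∀ i s, L (m22 (p i) s) = 0) : L = 0 := by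
  -- the degree three part of the ideal is a hyperplane
  have hinj : Function.Injective (lmap p) := by
    rw [← LinearMap.ker_eq_bot, LinearMap.ker_eq_bot']
    intro m hm
    exact hp.syzygy m (by rw [← lmap_apply, hm])
  have hr : Module.finrank ℝ (LinearMap.range (lmap p)) = 9 := by
    rw [LinearMap.finrank_range_of_inj hinj, Module.finrank_pi_fintype]
    simp
  obtain ⟨w, hw⟩ : ∃ w, w ∉ LinearMap.range (lmap p) := by
    by_contra hcon
    push Not at hcon
    have htop : LinearMap.range (lmap p) = ⊤ := Submodule.eq_top_iff'.2 hcon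
    rw [htop, finrank_top] at hr
    simp at hr
  have hsup : LinearMap.range (lmap p) ⊔ Submodule.span ℝ {w} = ⊤ := by
    apply Submodule.eq_top_of_finrank_eq
    have hlt : LinearMap.range (lmap p) < LinearMap.range (lmap p) ⊔ Submodule.span ℝ {w} := by
      refine lt_of_le_of_ne le_sup_left fun he => hw ?_
      rw [he]
      exact (le_sup_right : Submodule.span ℝ {w} ≤ _) (Submodule.mem_span_singleton_self w)
    have h1 := Submodule.finrank_lt_finrank_of_lt hlt
    have h2 := Submodule.finrank_le (LinearMap.range (lmap p) ⊔ Submodule.span ℝ {w})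
    rw [hr] at h1
    simp only [Module.finrank_pi, Fintype.card_fin] at h2 ⊢
    omega
  have hvan : ∀ j, ∀ c ∈ LinearMap.range (lmap p), L (m13 (xx j) c) = 0 := by
    rintro j _ ⟨m, rfl⟩
    rw [lmap_apply, ← m13L_apply]
    simp only [map_sum, m13L_apply, m13_m12, hL]
    simp
  obtain ⟨u, hud⟩ : ∃ u : Fin 3 → ℝ, ∀ j, u j = L (m13 (xx j) w) := ⟨_, fun _ => rfl⟩
  have hdec : ∀ c, ∃ t : ℝ, ∀ j, L (m13 (xx j) c) = u j * t := by
    intro c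
    have hc : c ∈ LinearMap.range (lmap p) ⊔ Submodule.span ℝ {w} := by rw [hsup]; trivial
    obtain ⟨r, hr, s, hs, rfl⟩ := Submodule.mem_sup.1 hc
    obtain ⟨t, rfl⟩ := Submodule.mem_span_singleton.1 hs
    refine ⟨t, fun j => ?_⟩
    rw [m13_add_right, m13_smul_right, map_add, map_smul, hvan j r hr, hud]
    simp [mul_comm]
  have hsw : ∀ i j c, L (m13 (xx i) c) * u j = u i * L (m13 (xx j) c) := by
    intro i j c
    obtain ⟨t, ht⟩ := hdec c
    rw [ht, ht]; ring
  have hu0 : (∃ j, u j ≠ 0) ∨ L = 0 := by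
    by_cases h : ∃ j, u j ≠ 0
    · exact Or.inl h
    · right
      push Not at h
      apply quartic_span
      intro i j k l
      obtain ⟨t, ht⟩ := hdec (m12 (xx j) (m11 (xx k) (xx l)))
      rw [ht, h]; simp
  rcases hu0 with ⟨j, hj⟩ | h0
  swap
  · exact h0
  -- `L` is a multiple of the evaluation at `u`
  have step2 : ∀ k l, L (m13 (xx j) (m12 (xx j) (m11 (xx k) (xx l)))) * u j ^ 2 =
      u k * u l * L (m13 (xx j) (m12 (xx j) (m11 (xx j) (xx j)))) := by
    intro k l
    have a1 : L (m13 (xx j) (m12 (xx j) (m11 (xx k) (xx l)))) * u j =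
        u k * L (m13 (xx j) (m12 (xx j) (m11 (xx j) (xx l)))) := by
      rw [m12_comm, m13_comm, hsw]
    have a2 : L (m13 (xx j) (m12 (xx j) (m11 (xx j) (xx l)))) * u j =
        u l * L (m13 (xx j) (m12 (xx j) (m11 (xx j) (xx j)))) := by
      rw [m11_comm, m12_comm, m13_comm, hsw]
    linear_combination u j * a1 + u k * a2
  have step4 : ∀ i i' k l, L (m13 (xx i) (m12 (xx i') (m11 (xx k) (xx l)))) * u j ^ 4 =
      u i * u i' * u k * u l * L (m13 (xx j) (m12 (xx j) (m11 (xx j) (xx j)))) := by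
    intro i i' k l
    have a1 := hsw i j (m12 (xx i') (m11 (xx k) (xx l)))
    have a2 := hsw i' j (m12 (xx j) (m11 (xx k) (xx l)))
    rw [m13_comm] at a2
    linear_combination u j ^ 3 * a1 + u i * u j ^ 2 * a2 + u i * u i' * step2 k l
  by_cases hz : L (m13 (xx j) (m12 (xx j) (m11 (xx j) (xx j)))) = 0
  · apply quartic_span
    intro i i' k l
    have := step4 i i' k l
    rw [hz, mul_zero] at this
    exact (mul_eq_zero.1 this).resolve_right (pow_ne_zero _ hj)
  · exfalso
    have hpu : ∀ i, e2 (p i) u = 0 := by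
      intro i
      have h1 := hL i (m11 (xx j) (xx j))
      have h2 : m22 (p i) (m11 (xx j) (xx j)) =
          p i 0 • m13 (xx j) (m12 (xx j) (m11 (xx 0) (xx 0)))
          + p i 1 • m13 (xx j) (m12 (xx j) (m11 (xx 1) (xx 1)))
          + p i 2 • m13 (xx j) (m12 (xx j) (m11 (xx 2) (xx 2)))
          + p i 3 • m13 (xx j) (m12 (xx j) (m11 (xx 0) (xx 1)))
          + p i 4 • m13 (xx j) (m12 (xx j) (m11 (xx 0) (xx 2)))
          + p i 5 • m13 (xx j) (m12 (xx j) (m11 (xx 1) (xx 2))) := by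
        rw [← m13_m12]
        have : p i = p i 0 • m11 (xx 0) (xx 0) + p i 1 • m11 (xx 1) (xx 1)
          + p i 2 • m11 (xx 2) (xx 2) + p i 3 • m11 (xx 0) (xx 1) + p i 4 • m11 (xx 0) (xx 2)
          + p i 5 • m11 (xx 1) (xx 2) := by
          ext t; fin_cases t <;> simp [m11, xx]
        conv_lhs => rw [this]
        simp only [← m13L_apply, ← m12L_apply, map_add, map_smul]
      rw [h2] at h1
      simp only [map_add, map_smul, smul_eq_mul] at h1
      apply (mul_eq_zero.1 (?_ : e2 (p i) u
        * L (m13 (xx j) (m12 (xx j) (m11 (xx j) (xx j)))) = 0)).resolve_right hz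
      rw [e2]
      linear_combination u j ^ 2 * h1 - p i 0 * step2 0 0 - p i 1 * step2 1 1 - p i 2 * step2 2 2
        - p i 3 * step2 0 1 - p i 4 * step2 0 2 - p i 5 * step2 1 2
    have := hp (toC u) (fun i => by
      have h := congrArg (fun t : ℝ => (t : ℂ)) (hpu i)
      simpa [e2, toC] using h)
    have := congrFun this j
    simp [toC] at this
    exact hj this

lemma BPF.surjective {p : Fin 3 → Fin 6 → ℝ} (hp : BPF p) : LinearMap.range (dmap p) = ⊤ := by
  by_contra h
  obtain ⟨L, hL0, hL⟩ := Submodule.exists_le_ker_of_lt_top _ (lt_top_iff_ne_top.2 h)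
  apply hL0
  apply hp.no_functional
  intro i s
  have := hL (LinearMap.mem_range_self (dmap p) (Pi.single i s))
  rw [LinearMap.mem_ker, dmap_apply] at this
  rw [← this]
  congr 1
  rw [Finset.sum_eq_single i]
  · simp
  · intro k _ hk
    rw [Pi.single_eq_of_ne hk, ← m22L_apply, LinearMap.map_zero]
  · simp

set_option linter.unusedSimpArgs false
/-! ### The sum of squares map -/

/-- `p ↦ ∑ pᵢ²` -/
def sos (p : Fin 3 → Fin 6 → ℝ) : Fin 15 → ℝ := ∑ i, m22 (p i) (p i)

/-- continuous bilinear version of `m22` -/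
noncomputable def m22C : (Fin 6 → ℝ) →L[ℝ] (Fin 6 → ℝ) →L[ℝ] (Fin 15 → ℝ) :=
  LinearMap.toContinuousLinearMap
    ((LinearMap.toContinuousLinearMap (𝕜 := ℝ) (E := Fin 6 → ℝ) (F' := Fin 15 → ℝ)).toLinearMap ∘ₗ m22L)

lemma m22C_apply (p q : Fin 6 → ℝ) : m22C p q = m22 p q := rfl

lemma m22_comm (p q : Fin 6 → ℝ) : m22 p q = m22 q p := by
  simp only [m22]; ring_nf

lemma sos_hasStrictFDerivAt (p : Fin 3 → Fin 6 → ℝ) :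
    HasStrictFDerivAt sos ((2 : ℝ) • LinearMap.toContinuousLinearMap (dmap p)) p := by
  have h1 : ∀ i : Fin 3, HasStrictFDerivAt (fun q : Fin 3 → Fin 6 → ℝ => q i)
      (ContinuousLinearMap.proj i) p := fun i =>
    (ContinuousLinearMap.proj (R := ℝ) (φ := fun _ : Fin 3 => Fin 6 → ℝ) i).hasStrictFDerivAt
  have h2 := fun i => m22C.hasStrictFDerivAt_of_bilinear (h1 i) (h1 i)
  have h3 := HasStrictFDerivAt.fun_sum (u := Finset.univ) (fun i _ => h2 i)
  refine (h3.congr_fderiv ?_)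
  ext1 u
  simp only [_root_.sum_apply, _root_.add_apply,
    _root_.smul_apply, LinearMap.coe_toContinuousLinearMap', dmap_apply,
    Finset.smul_sum]
  refine Finset.sum_congr rfl fun i _ => ?_
  simp [ContinuousLinearMap.precompR, ContinuousLinearMap.precompL, m22C_apply, m22_comm (u i), two_smul]

lemma BPF.map_nhds {p : Fin 3 → Fin 6 → ℝ} (hp : BPF p) :
    Filter.map sos (nhds p) = nhds (sos p) := by
  apply (sos_hasStrictFDerivAt p).map_nhds_eq_of_surj
  rw [eq_top_iff]
  rintro y -
  have hy : y ∈ LinearMap.range (dmap p) := by rw [hp.surjective]; trivial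
  obtain ⟨u, hu⟩ := hy
  refine ⟨(1 / 2 : ℝ) • u, ?_⟩
  simp [hu]

lemma continuous_sos : Continuous sos :=
  continuous_iff_continuousAt.2 fun p => (sos_hasStrictFDerivAt p).continuousAt

lemma e4_add (F G : Fin 15 → ℝ) (x : Fin 3 → ℝ) : e4 (F + G) x = e4 F x + e4 G x := by
  simp [e4]; ring
lemma e4_smul (t : ℝ) (F : Fin 15 → ℝ) (x : Fin 3 → ℝ) : e4 (t • F) x = t * e4 F x := by
  simp [e4]; ring
lemma e4_scale (t : ℝ) (F : Fin 15 → ℝ) (x : Fin 3 → ℝ) : e4 F (t • x) = t ^ 4 * e4 F x := by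
  simp [e4]; ring
lemma e2_scale (t : ℝ) (F : Fin 6 → ℝ) (x : Fin 3 → ℝ) : e2 F (t • x) = t ^ 2 * e2 F x := by
  simp [e2]; ring

lemma e4_sos (p : Fin 3 → Fin 6 → ℝ) (x : Fin 3 → ℝ) : e4 (sos p) x = ∑ i, e2 (p i) x ^ 2 := by
  simp only [sos, Fin.sum_univ_three, e4_add, e4_m22]; ring

lemma e4_le (F : Fin 15 → ℝ) (x : Fin 3 → ℝ) (hx : ‖x‖ ≤ 1) : |e4 F x| ≤ 15 * ‖F‖ := by
  have h : ∀ i, |x i| ≤ 1 := fun i => (norm_le_pi_norm x i).trans hx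
  have hF : ∀ i, |F i| ≤ ‖F‖ := fun i => norm_le_pi_norm F i
  have hn := norm_nonneg F
  have key : ∀ i (m : ℝ), |m| ≤ 1 → |F i * m| ≤ ‖F‖ := by
    intro i m hm
    rw [abs_mul]
    nlinarith [hF i, abs_nonneg (F i), abs_nonneg m]
  have hm : ∀ a b : ℝ, |a| ≤ 1 → |b| ≤ 1 → |a * b| ≤ 1 := by
    intro a b ha hb
    rw [abs_mul]; exact mul_le_one₀ ha (abs_nonneg _) hb
  have hp : ∀ (a : ℝ) (n : ℕ), |a| ≤ 1 → |a ^ n| ≤ 1 := by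
    intro a n ha
    rw [abs_pow]; exact pow_le_one₀ (abs_nonneg _) ha
  have k0 := abs_le.1 (key 0 _ (hp _ 4 (h 0)))
  have k1 := abs_le.1 (key 1 _ (hp _ 4 (h 1)))
  have k2 := abs_le.1 (key 2 _ (hp _ 4 (h 2)))
  have k3 := abs_le.1 (key 3 _ (hm _ _ (hp _ 3 (h 0)) (h 1)))
  have k4 := abs_le.1 (key 4 _ (hm _ _ (hp _ 3 (h 0)) (h 2)))
  have k5 := abs_le.1 (key 5 _ (hm _ _ (hp _ 3 (h 1)) (h 0)))
  have k6 := abs_le.1 (key 6 _ (hm _ _ (hp _ 3 (h 1)) (h 2)))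
  have k7 := abs_le.1 (key 7 _ (hm _ _ (hp _ 3 (h 2)) (h 0)))
  have k8 := abs_le.1 (key 8 _ (hm _ _ (hp _ 3 (h 2)) (h 1)))
  have k9 := abs_le.1 (key 9 _ (hm _ _ (hp _ 2 (h 0)) (hp _ 2 (h 1))))
  have k10 := abs_le.1 (key 10 _ (hm _ _ (hp _ 2 (h 0)) (hp _ 2 (h 2))))
  have k11 := abs_le.1 (key 11 _ (hm _ _ (hp _ 2 (h 1)) (hp _ 2 (h 2))))
  have k12 := abs_le.1 (key 12 _ (hm _ _ (hm _ _ (hp _ 2 (h 0)) (h 1)) (h 2)))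
  have k13 := abs_le.1 (key 13 _ (hm _ _ (hm _ _ (h 0) (hp _ 2 (h 1))) (h 2)))
  have k14 := abs_le.1 (key 14 _ (hm _ _ (hm _ _ (h 0) (h 1)) (hp _ 2 (h 2))))
  rw [abs_le, e4]
  constructor <;> linarith [k0.1, k0.2, k1.1, k1.2, k2.1, k2.2, k3.1, k3.2, k4.1, k4.2, k5.1, k5.2,
    k6.1, k6.2, k7.1, k7.2, k8.1, k8.2, k9.1, k9.2, k10.1, k10.2, k11.1, k11.2, k12.1, k12.2,
    k13.1, k13.2, k14.1, k14.2]

/-- positive definite quartics -/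
def PD (F : Fin 15 → ℝ) : Prop := ∀ x : Fin 3 → ℝ, x ≠ 0 → 0 < e4 F x

lemma PD.nhds {F : Fin 15 → ℝ} (hF : PD F) : ∀ᶠ G in nhds F, PD G := by
  have hc : Continuous (fun x : Fin 3 → ℝ => e4 F x) := by
    unfold e4; fun_prop
  have hne : (Metric.sphere (0 : Fin 3 → ℝ) 1).Nonempty :=
    ⟨fun _ => 1, by simp [pi_norm_const]⟩
  obtain ⟨x0, hx0, hmin⟩ := (isCompact_sphere (0 : Fin 3 → ℝ) 1).exists_isMinOn hne hc.continuousOn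
  have hx0' : x0 ≠ 0 := by
    rintro rfl; simp at hx0
  have hpos := hF x0 hx0'
  refine Metric.eventually_nhds_iff.2 ⟨e4 F x0 / 15, by positivity, fun G hG x hx => ?_⟩
  have hxn : 0 < ‖x‖ := norm_pos_iff.2 hx
  have hs : ‖(‖x‖⁻¹ • x)‖ = 1 := by
    rw [norm_smul, norm_inv, norm_norm, inv_mul_cancel₀ hxn.ne']
  have h1 := hmin (show ‖x‖⁻¹ • x ∈ Metric.sphere (0 : Fin 3 → ℝ) 1 by simpa using hs)
  have h2 := abs_le.1 (e4_le (G - F) (‖x‖⁻¹ • x) hs.le)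
  have h3 : G = F + (G - F) := by abel
  have h4 : 0 < e4 G (‖x‖⁻¹ • x) := by
    rw [h3, e4_add]
    rw [dist_eq_norm] at hG
    simp only [Set.mem_ofPred_eq] at h1
    linarith [h2.1]
  rw [e4_scale] at h4
  exact pos_of_mul_pos_right h4 (by positivity)

lemma sos_bound (p : Fin 3 → Fin 6 → ℝ) : ‖p‖ ≤ 3 * Real.sqrt (15 * ‖sos p‖) := by
  set R := Real.sqrt (15 * ‖sos p‖) with hR
  have hRn : 0 ≤ R := Real.sqrt_nonneg _
  have hv : ∀ x : Fin 3 → ℝ, ‖x‖ ≤ 1 → ∀ i, |e2 (p i) x| ≤ R := by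
    intro x hx i
    apply Real.abs_le_sqrt
    have h1 := (le_abs_self _).trans (e4_le (sos p) x hx)
    rw [e4_sos] at h1
    refine le_trans ?_ h1
    exact Finset.single_le_sum (f := fun i => e2 (p i) x ^ 2) (fun j _ => sq_nonneg _)
      (Finset.mem_univ i)
  rw [pi_norm_le_iff_of_nonneg (by positivity)]
  intro i
  have nrm : ∀ a b c : ℝ, |a| ≤ 1 → |b| ≤ 1 → |c| ≤ 1 → ‖(![a, b, c] : Fin 3 → ℝ)‖ ≤ 1 := by
    intro a b c ha hb hc
    rw [pi_norm_le_iff_of_nonneg zero_le_one]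
    intro j; fin_cases j <;> simpa
  have a1 := abs_le.1 (hv ![1, 0, 0] (nrm _ _ _ (by simp) (by simp) (by simp)) i)
  have a2 := abs_le.1 (hv ![0, 1, 0] (nrm _ _ _ (by simp) (by simp) (by simp)) i)
  have a3 := abs_le.1 (hv ![0, 0, 1] (nrm _ _ _ (by simp) (by simp) (by simp)) i)
  have a4 := abs_le.1 (hv ![1, 1, 0] (nrm _ _ _ (by simp) (by simp) (by simp)) i)
  have a5 := abs_le.1 (hv ![1, 0, 1] (nrm _ _ _ (by simp) (by simp) (by simp)) i)
  have a6 := abs_le.1 (hv ![0, 1, 1] (nrm _ _ _ (by simp) (by simp) (by simp)) i)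
  simp [e2] at a1 a2 a3 a4 a5 a6
  rw [pi_norm_le_iff_of_nonneg (by positivity)]
  intro j
  rw [Real.norm_eq_abs, abs_le]
  fin_cases j <;> simp <;> constructor <;> linarith [a1.1, a1.2, a2.1, a2.2, a3.1, a3.2, a4.1, a4.2, a5.1, a5.2, a6.1, a6.2]

lemma isClosed_range_sos : IsClosed (Set.range sos) := by
  rw [← isSeqClosed_iff_isClosed]
  intro y F hy hF
  choose p hp using hy
  obtain ⟨C, hC⟩ := (Metric.isBounded_range_of_tendsto y hF).exists_norm_le
  have hb : ∀ n, p n ∈ Metric.closedBall (0 : Fin 3 → Fin 6 → ℝ) (3 * Real.sqrt (15 * C)) := by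
    intro n
    rw [mem_closedBall_zero_iff]
    refine (sos_bound (p n)).trans ?_
    rw [hp]
    have := hC (y n) (Set.mem_range_self n)
    gcongr
  obtain ⟨q, -, k, hk, hq⟩ := (isCompact_closedBall (0 : Fin 3 → Fin 6 → ℝ) _).tendsto_subseq hb
  refine ⟨q, tendsto_nhds_unique ((continuous_sos.tendsto q).comp hq) ?_⟩
  have : sos ∘ p ∘ k = y ∘ k := by ext1 n; simp [hp]
  rw [this]
  exact hF.comp hk.tendsto_atTop

set_option linter.unusedSimpArgs false
/-! ### A nowhere dense set of bad quartics -/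

/-- the quartic `x⁴ + y⁴ + z⁴` -/
def g0 : Fin 15 → ℝ := ![1, 1, 1, 0, 0, 0, 0, 0, 0, 0, 0, 0, 0, 0, 0]

/-- parametrisation of bad quartics -/
def psi (l n : Fin 3 → ℝ) (q s : Fin 6 → ℝ) (c c0 : ℝ) : Fin 15 → ℝ :=
  m22 (m11 l l) s + m22 (m11 l n) q + c • m22 q q + c0 • g0

/-- linear form of a chart -/
def chL (k : Fin 3) (w : Fin 14 → ℝ) : Fin 3 → ℝ :=
  ![![1, w 0, w 1], ![w 0, 1, w 1], ![w 0, w 1, 1]] k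
/-- second linear form of a chart -/
def chN (k : Fin 3) (w : Fin 14 → ℝ) : Fin 3 → ℝ :=
  ![![0, w 4, w 5], ![w 4, 0, w 5], ![w 4, w 5, 0]] k
/-- quadratic form of a chart -/
def chQ (k : Fin 3) (w : Fin 14 → ℝ) : Fin 6 → ℝ :=
  ![![0, w 3, 1, 0, 0, w 2], ![w 3, 0, 1, 0, w 2, 0], ![w 3, 1, 0, w 2, 0, 0]] k
/-- cofactor of a chart -/
def chS (w : Fin 14 → ℝ) : Fin 6 → ℝ := ![w 6, w 7, w 8, w 9, w 10, w 11]

/-- the charts -/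
def chart (k : Fin 3) (w : Fin 14 → ℝ) : Fin 15 → ℝ :=
  psi (chL k w) (chN k w) (chQ k w) (chS w) (w 12) (w 13)

/-- bad quartics -/
def bad : Set (Fin 15 → ℝ) := ⋃ k, Set.range (chart k)

lemma contDiff_m22 {f g : (Fin 14 → ℝ) → (Fin 6 → ℝ)} (hf : ContDiff ℝ 1 f) (hg : ContDiff ℝ 1 g) :
    ContDiff ℝ 1 (fun w => m22 (f w) (g w)) :=
  m22C.isBoundedBilinearMap.contDiff.comp₂ hf hg

lemma contDiff_m11 {f g : (Fin 14 → ℝ) → (Fin 3 → ℝ)} (hf : ContDiff ℝ 1 f) (hg : ContDiff ℝ 1 g) :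
    ContDiff ℝ 1 (fun w => m11 (f w) (g w)) := by
  rw [contDiff_pi] at hf hg ⊢
  have h0 := hf 0
  have h1 := hf 1
  have h2 := hf 2
  have k0 := hg 0
  have k1 := hg 1
  have k2 := hg 2
  intro i
  fin_cases i <;> simp [m11] <;> fun_prop

lemma contDiff_chart (k : Fin 3) : ContDiff ℝ 1 (chart k) := by
  have hL : ContDiff ℝ 1 (chL k) := by
    rw [contDiff_pi]; intro i; fin_cases k <;> fin_cases i <;> simp [chL] <;> fun_prop
  have hN : ContDiff ℝ 1 (chN k) := by
    rw [contDiff_pi]; intro i; fin_cases k <;> fin_cases i <;> simp [chN] <;> fun_prop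
  have hQ : ContDiff ℝ 1 (chQ k) := by
    rw [contDiff_pi]; intro i; fin_cases k <;> fin_cases i <;> simp [chQ] <;> fun_prop
  have hS : ContDiff ℝ 1 chS := by
    rw [contDiff_pi]; intro i; fin_cases i <;> simp [chS] <;> fun_prop
  unfold chart psi
  have a1 := contDiff_m22 (contDiff_m11 hL hL) hS
  have a2 := contDiff_m22 (contDiff_m11 hL hN) hQ
  have a3 := contDiff_m22 hQ hQ
  have a4 : ContDiff ℝ 1 (fun w : Fin 14 → ℝ => w 12) := by fun_prop
  have a5 : ContDiff ℝ 1 (fun w : Fin 14 → ℝ => w 13) := by fun_prop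
  exact ((a1.add a2).add (a4.smul a3)).add (a5.smul contDiff_const)

lemma dense_compl_bad : Dense badᶜ := by
  apply dense_compl_of_dimH_lt_finrank
  rw [bad, dimH_iUnion]
  refine lt_of_le_of_lt (iSup_le fun k => (contDiff_chart k).dimH_range_le) ?_
  simp
  norm_num

lemma sos_psi (p : Fin 3 → Fin 6 → ℝ) (l n : Fin 3 → ℝ) (t : ℝ) (q : Fin 6 → ℝ)
    (m : Fin 3 → Fin 3 → ℝ) (c : Fin 3 → ℝ) (hp : ∀ i, p i = m11 l (m i) + c i • q)
    (hn : ∑ i, (2 * c i) • m i = t • l + n) :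
    sos p = psi l n q (∑ i, m11 (m i) (m i) + t • q) (∑ i, c i ^ 2) 0 := by
  have h1 : ∀ i, m22 (p i) (p i) = m22 (m11 l l) (m11 (m i) (m i))
      + m22 (m11 l ((2 * c i) • m i)) q + (c i ^ 2) • m22 q q := by
    intro i
    have a1 : m22 (m11 l (m i)) (m11 l (m i)) = m22 (m11 l l) (m11 (m i) (m i)) := by
      rw [← m13_m12, m12_comm, m13_m12, m22_comm]
    have a2 : m11 l ((2 * c i) • m i) = (2 * c i) • m11 l (m i) := by
      ext j; fin_cases j <;> simp [m11] <;> ring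
    rw [hp, a2]
    simp only [m22_add_left, m22_add_right, m22_smul_left, m22_smul_right, a1,
      m22_comm q (m11 l (m i))]
    module
  have h2 : ∑ i, m11 l ((2 * c i) • m i) = t • m11 l l + m11 l n := by
    have b1 : ∑ i, m11 l ((2 * c i) • m i) = m11 l (∑ i, (2 * c i) • m i) := by
      ext j; fin_cases j <;> simp [m11, Fin.sum_univ_three] <;> ring
    rw [b1, hn]
    ext j; fin_cases j <;> simp [m11] <;> ring
  have h3 : ∑ i, m22 (m11 l ((2 * c i) • m i)) q = m22 (t • m11 l l + m11 l n) q := by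
    rw [← h2]; simp only [Fin.sum_univ_three, m22_add_left]
  have h4 : ∑ i, m22 (m11 l l) (m11 (m i) (m i)) = m22 (m11 l l) (∑ i, m11 (m i) (m i)) := by
    simp only [Fin.sum_univ_three, m22_add_right]
  rw [sos]
  simp only [h1, Finset.sum_add_distrib, h3, h4, psi]
  rw [← Finset.sum_smul]
  simp only [m22_add_left, m22_add_right, m22_smul_left, m22_smul_right]
  module

lemma psi_scale (l n : Fin 3 → ℝ) (q s : Fin 6 → ℝ) (c a b : ℝ) :
    a • psi l n q s c 0 + b • g0 = psi l (a • n) q (a • s) (a * c) b := by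
  have : m11 l (a • n) = a • m11 l n := by
    ext j; fin_cases j <;> simp [m11] <;> ring
  simp only [psi, this, m22_smul_left, m22_smul_right]
  module

lemma chart_scalar (p0 p1 p2 p3 p4 p5 α β : ℝ) (τ : ℂ) (hτ : τ.im ≠ 0)
    (h : (p0 : ℂ) + p1 * τ ^ 2 + p2 * (-α - β * τ) ^ 2 + p3 * τ + p4 * (-α - β * τ)
      + p5 * (τ * (-α - β * τ)) = 0) :
    p0 - α * (p4 - α * p2) = (p1 - β * (p5 - β * p2)) * (τ.re ^ 2 + τ.im ^ 2) ∧
    p3 - α * (p5 - β * p2) - β * (p4 - α * p2)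
      = (p1 - β * (p5 - β * p2)) * (-2 * τ.re) := by
  have hre := congrArg Complex.re h
  have him := congrArg Complex.im h
  simp [pow_two] at hre him
  have h2 : p3 - α * (p5 - β * p2) - β * (p4 - α * p2)
      = (p1 - β * (p5 - β * p2)) * (-2 * τ.re) := by
    apply mul_left_cancel₀ hτ
    linear_combination him
  refine ⟨?_, h2⟩
  linear_combination hre - τ.re * h2

lemma bad_of_chart (p : Fin 3 → Fin 6 → ℝ) (a : Fin 3 → ℂ) (ha : ∀ i, e2 (toC (p i)) a = 0)
    (i j : Fin 3) (hij : i < j) (hi : a i = 1) (hj : (a j).im ≠ 0) (A B : ℝ) :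
    A • sos p + B • g0 ∈ bad := by
  -- the third coordinate is a real combination
  have hlin : ∀ k, ∃ α β : ℝ, a k = -α - β * a j := by
    intro k
    refine ⟨-(a k).re + (a k).im / (a j).im * (a j).re, -(a k).im / (a j).im, ?_⟩
    apply Complex.ext
    · simp; ring
    · simp; field_simp
  suffices h : ∃ k, ∃ w : Fin 14 → ℝ, ∃ (m : Fin 3 → Fin 3 → ℝ) (c : Fin 3 → ℝ),
      (∀ i, p i = m11 (chL k w) (m i) + c i • chQ k w) by
    obtain ⟨k, w, m, c, hp⟩ := h
    set N : Fin 3 → ℝ := ∑ i, (2 * c i) • m i with hN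
    set n : Fin 3 → ℝ := N - N k • chL k w with hn
    have hs := sos_psi p (chL k w) n (N k) (chQ k w) m c hp (by rw [hn]; abel)
    set s := ∑ i, m11 (m i) (m i) + N k • chQ k w with hsd
    rw [hs, psi_scale]
    clear_value s n
    refine Set.mem_iUnion.2 ⟨k, ?_⟩
    have hS : ∀ v : Fin 14 → ℝ, v 6 = A * s 0 → v 7 = A * s 1 → v 8 = A * s 2 → v 9 = A * s 3 →
        v 10 = A * s 4 → v 11 = A * s 5 → chS v = A • s := by
      intro v h0 h1 h2 h3 h4 h5
      ext j; fin_cases j <;> simp [chS, *]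
    fin_cases k
    · have hn0 : n 0 = 0 := by rw [hn]; simp [chL]
      refine ⟨![w 0, w 1, w 2, w 3, A * n 1, A * n 2, A * s 0, A * s 1, A * s 2, A * s 3, A * s 4,
        A * s 5, A * ∑ i, c i ^ 2, B], ?_⟩
      rw [chart, hS _ rfl rfl rfl rfl rfl rfl]
      congr 1
      ext j; fin_cases j <;> simp [chN, hn0]
    · have hn0 : n 1 = 0 := by rw [hn]; simp [chL]
      refine ⟨![w 0, w 1, w 2, w 3, A * n 0, A * n 2, A * s 0, A * s 1, A * s 2, A * s 3, A * s 4,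
        A * s 5, A * ∑ i, c i ^ 2, B], ?_⟩
      rw [chart, hS _ rfl rfl rfl rfl rfl rfl]
      congr 1
      ext j; fin_cases j <;> simp [chN, hn0]
    · have hn0 : n 2 = 0 := by rw [hn]; simp [chL]
      refine ⟨![w 0, w 1, w 2, w 3, A * n 0, A * n 1, A * s 0, A * s 1, A * s 2, A * s 3, A * s 4,
        A * s 5, A * ∑ i, c i ^ 2, B], ?_⟩
      rw [chart, hS _ rfl rfl rfl rfl rfl rfl]
      congr 1
      ext j; fin_cases j <;> simp [chN, hn0]
  have hcases : (i = 0 ∧ j = 1) ∨ (i = 0 ∧ j = 2) ∨ (i = 1 ∧ j = 2) := by omega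
  rcases hcases with ⟨rfl, rfl⟩ | ⟨rfl, rfl⟩ | ⟨rfl, rfl⟩
  · obtain ⟨α, β, hk⟩ := hlin 2
    refine ⟨2, ![α, β, -2 * (a 1).re, (a 1).re ^ 2 + (a 1).im ^ 2, 0, 0, 0, 0, 0, 0, 0, 0, 0, 0],
      fun i => ![p i 4 - α * p i 2, p i 5 - β * p i 2, p i 2],
      fun i => p i 1 - β * (p i 5 - β * p i 2), fun i => ?_⟩
    obtain ⟨h1, h2⟩ := chart_scalar (p i 0) (p i 1) (p i 2) (p i 3) (p i 4) (p i 5) α β (a 1) hj (by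
      rw [← ha i, e2, ← hk, hi]; simp [toC])
    ext j; fin_cases j <;> simp [m11, chL, chQ] <;> linarith
  · obtain ⟨α, β, hk⟩ := hlin 1
    refine ⟨1, ![α, β, -2 * (a 2).re, (a 2).re ^ 2 + (a 2).im ^ 2, 0, 0, 0, 0, 0, 0, 0, 0, 0, 0],
      fun i => ![p i 3 - α * p i 1, p i 1, p i 5 - β * p i 1],
      fun i => p i 2 - β * (p i 5 - β * p i 1), fun i => ?_⟩
    obtain ⟨h1, h2⟩ := chart_scalar (p i 0) (p i 2) (p i 1) (p i 4) (p i 3) (p i 5) α β (a 2) hj (by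
      rw [← ha i, e2, ← hk, hi]; simp [toC]; ring)
    ext j; fin_cases j <;> simp [m11, chL, chQ] <;> linarith
  · obtain ⟨α, β, hk⟩ := hlin 0
    refine ⟨0, ![α, β, -2 * (a 2).re, (a 2).re ^ 2 + (a 2).im ^ 2, 0, 0, 0, 0, 0, 0, 0, 0, 0, 0],
      fun i => ![p i 0, p i 3 - α * p i 0, p i 4 - β * p i 0],
      fun i => p i 2 - β * (p i 4 - β * p i 0), fun i => ?_⟩
    obtain ⟨h1, h2⟩ := chart_scalar (p i 1) (p i 2) (p i 0) (p i 5) (p i 3) (p i 4) α β (a 2) hj (by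
      rw [← ha i, e2, ← hk, hi]; simp [toC]; ring)
    ext j; fin_cases j <;> simp [m11, chL, chQ] <;> linarith

lemma e2_smul_complex (p : Fin 6 → ℂ) (t : ℂ) (x : Fin 3 → ℂ) : e2 p (t • x) = t ^ 2 * e2 p x := by
  simp [e2]; ring

lemma bad_or_real (p : Fin 3 → Fin 6 → ℝ) (hp : ¬ BPF p) :
    (∃ b : Fin 3 → ℝ, b ≠ 0 ∧ ∀ i, e2 (p i) b = 0) ∨ ∀ A B : ℝ, A • sos p + B • g0 ∈ bad := by
  unfold BPF at hp
  push Not at hp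
  obtain ⟨a, ha, ha0⟩ := hp
  obtain ⟨i, hi⟩ := Function.ne_iff.1 ha0
  simp only [Pi.zero_apply] at hi
  by_cases hr : ∀ j, (a j / a i).im = 0
  · left
    refine ⟨fun j => (a j / a i).re, fun h => ?_, fun k => ?_⟩
    · have := congrFun h i
      simp [div_self hi] at this
    · have hb : toC (fun j => (a j / a i).re) = (a i)⁻¹ • a := by
        ext j
        apply Complex.ext
        · simp only [toC, Complex.ofReal_re, Pi.smul_apply, smul_eq_mul, div_eq_inv_mul]
        · have := hr j
          rw [div_eq_inv_mul] at this
          simp only [toC, Complex.ofReal_im, Pi.smul_apply, smul_eq_mul, this]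
      have h1 : e2 (toC (p k)) (toC (fun j => (a j / a i).re)) = 0 := by
        rw [hb, e2_smul_complex, ha k, mul_zero]
      have h2 : ((e2 (p k) (fun j => (a j / a i).re) : ℝ) : ℂ) = 0 := by
        rw [← h1]; simp only [e2, toC]; push_cast; ring
      exact_mod_cast h2
  · right
    push Not at hr
    obtain ⟨j, hj⟩ := hr
    intro A B
    have hz : ∀ t : ℂ, ∀ k, e2 (toC (p k)) (t • a) = 0 := fun t k => by
      rw [e2_smul_complex, ha k, mul_zero]
    have hne : i ≠ j := by rintro rfl; simp [div_self hi] at hj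
    rcases lt_or_gt_of_ne hne with h | h
    · exact bad_of_chart p ((a i)⁻¹ • a) (hz _) i j h (by simp [hi])
        (by rw [div_eq_inv_mul] at hj; simpa using hj) A B
    · have haj : a j ≠ 0 := by intro h0; simp [h0] at hj
      refine bad_of_chart p ((a j)⁻¹ • a) (hz _) j i h (by simp [haj]) ?_ A B
      have : ((a j)⁻¹ • a) i = (a j / a i)⁻¹ := by
        rw [Pi.smul_apply, smul_eq_mul, inv_div, div_eq_inv_mul]
      rw [this, Complex.inv_im]
      have : a j / a i ≠ 0 := div_ne_zero haj hi
      exact div_ne_zero (neg_ne_zero.2 hj) (by simpa using this)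

/-! ### Hilbert's theorem for positive definite ternary quartics -/

/-- `(x², y², z²)` -/
def p00 : Fin 3 → Fin 6 → ℝ := ![![1, 0, 0, 0, 0, 0], ![0, 1, 0, 0, 0, 0], ![0, 0, 1, 0, 0, 0]]

lemma sos_p00 : sos p00 = g0 := by
  have h0 : p00 0 = ![1, 0, 0, 0, 0, 0] := rfl
  have h1 : p00 1 = ![0, 1, 0, 0, 0, 0] := rfl
  have h2 : p00 2 = ![0, 0, 1, 0, 0, 0] := rfl
  rw [sos, Fin.sum_univ_three, h0, h1, h2]
  simp [m22, g0]

lemma bpf_p00 : BPF p00 := by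
  intro a h
  have h0 := h 0
  have h1 := h 1
  have h2 := h 2
  simp [e2, toC, p00] at h0 h1 h2
  ext j; fin_cases j <;> simpa

lemma PD_g0 : PD g0 := by
  intro x hx
  obtain ⟨i, hi⟩ := Function.ne_iff.1 hx
  simp only [Pi.zero_apply] at hi
  have h : e4 g0 x = x 0 ^ 4 + x 1 ^ 4 + x 2 ^ 4 := by simp [e4, g0]
  rw [h]
  have h4 : 0 < x i ^ 4 := by positivity
  have a0 : 0 ≤ x 0 ^ 4 := by positivity
  have a1 : 0 ≤ x 1 ^ 4 := by positivity
  have a2 : 0 ≤ x 2 ^ 4 := by positivity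
  fin_cases i <;> simp at h4 <;> linarith

lemma hilbert_generic {F : Fin 15 → ℝ} (hF : PD F) (hb : F ∉ bad) : F ∈ Set.range sos := by
  set γ : ℝ → (Fin 15 → ℝ) := fun t => (1 - t) • g0 + t • F with hγ
  have hc : Continuous γ := by rw [hγ]; fun_prop
  have hclosed : IsClosed (γ ⁻¹' Set.range sos ∩ Set.Icc 0 1) :=
    (isClosed_range_sos.preimage hc).inter isClosed_Icc
  have hsub : Set.Icc (0 : ℝ) 1 ⊆ γ ⁻¹' Set.range sos := by
    apply IsClosed.Icc_subset_of_forall_exists_gt hclosed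
    · exact ⟨p00, by rw [sos_p00, hγ]; simp⟩
    · rintro t ⟨ht, ht0, ht1⟩ y hy
      have hbpf : ∃ p, BPF p ∧ sos p = γ t := by
        rcases ht0.eq_or_lt with h0 | hpos
        · exact ⟨p00, bpf_p00, by rw [sos_p00, hγ, ← h0]; simp⟩
        · obtain ⟨p, hp⟩ := ht
          refine ⟨p, ?_, hp⟩
          by_contra hn
          rcases bad_or_real p hn with ⟨b, hb0, hbz⟩ | hbad
          · have h1 : e4 (γ t) b = 0 := by rw [← hp, e4_sos]; simp [hbz]
            have h2 : 0 < e4 (γ t) b := by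
              rw [hγ]
              simp only [e4_add, e4_smul]
              have := PD_g0 b hb0
              have := hF b hb0
              have : 0 < 1 - t := by linarith
              positivity
            exact h2.ne' h1
          · apply hb
            have := hbad t⁻¹ (-(t⁻¹ * (1 - t)))
            rw [hp, hγ] at this
            convert this using 1
            simp only [smul_add, smul_smul, inv_mul_cancel₀ hpos.ne', one_smul]
            module
      obtain ⟨p, hp, hpt⟩ := hbpf
      have hn : Set.range sos ∈ nhds (γ t) := by
        rw [← hpt, ← hp.map_nhds]
        exact Filter.range_mem_map
      have h1 : γ ⁻¹' Set.range sos ∈ nhds t := hc.continuousAt hn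
      have h2 : ∀ᶠ s in nhdsWithin t (Set.Ioi t), s ∈ γ ⁻¹' Set.range sos :=
        mem_nhdsWithin_of_mem_nhds h1
      have h3 : ∀ᶠ s in nhdsWithin t (Set.Ioi t), s ∈ Set.Ioc t y :=
        Ioc_mem_nhdsGT hy
      exact (h2.and h3).exists
  have := hsub (show (1 : ℝ) ∈ Set.Icc (0 : ℝ) 1 by simp)
  simpa [hγ] using this

lemma hilbert {F : Fin 15 → ℝ} (hF : PD F) : F ∈ Set.range sos := by
  rw [← isClosed_range_sos.closure_eq]
  rw [mem_closure_iff_nhds]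
  intro U hU
  obtain ⟨G, hGb, hG, hpd⟩ := dense_compl_bad.inter_nhds_nonempty (Filter.inter_mem hU hF.nhds)
  exact ⟨G, hG, hilbert_generic hpd hGb⟩

set_option linter.unusedSimpArgs false
/-! ### Passing from polynomials to coefficient vectors -/

lemma e4_sum {ι : Type*} (s : Finset ι) (F : ι → Fin 15 → ℝ) (x : Fin 3 → ℝ) :
    e4 (∑ i ∈ s, F i) x = ∑ i ∈ s, e4 (F i) x := by
  classical
  induction s using Finset.induction_on with
  | empty => simp [e4]
  | insert a s ha ih => rw [Finset.sum_insert ha, Finset.sum_insert ha, e4_add, ih]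

lemma monomial_e4 (a b c : ℕ) (h : a + b + c = 4) : ∃ F : Fin 15 → ℝ, ∀ x : Fin 3 → ℝ,
    x 0 ^ a * x 1 ^ b * x 2 ^ c = e4 F x := by
  have ha : a ≤ 4 := by omega
  have hb : b ≤ 4 := by omega
  have hc : c = 4 - a - b := by omega
  subst hc
  interval_cases a <;> interval_cases b <;> first
    | omega
    | (refine ⟨![1,0,0,0,0,0,0,0,0,0,0,0,0,0,0], fun x => ?_⟩; simp [e4]; done)
    | (refine ⟨![0,1,0,0,0,0,0,0,0,0,0,0,0,0,0], fun x => ?_⟩; simp [e4]; done)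
    | (refine ⟨![0,0,1,0,0,0,0,0,0,0,0,0,0,0,0], fun x => ?_⟩; simp [e4]; done)
    | (refine ⟨![0,0,0,1,0,0,0,0,0,0,0,0,0,0,0], fun x => ?_⟩; simp [e4]; done)
    | (refine ⟨![0,0,0,0,1,0,0,0,0,0,0,0,0,0,0], fun x => ?_⟩; simp [e4]; done)
    | (refine ⟨![0,0,0,0,0,1,0,0,0,0,0,0,0,0,0], fun x => ?_⟩; simp [e4, mul_comm]; done)
    | (refine ⟨![0,0,0,0,0,0,1,0,0,0,0,0,0,0,0], fun x => ?_⟩; simp [e4, mul_comm]; done)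
    | (refine ⟨![0,0,0,0,0,0,0,1,0,0,0,0,0,0,0], fun x => ?_⟩; simp [e4, mul_comm]; done)
    | (refine ⟨![0,0,0,0,0,0,0,0,1,0,0,0,0,0,0], fun x => ?_⟩; simp [e4, mul_comm]; done)
    | (refine ⟨![0,0,0,0,0,0,0,0,0,1,0,0,0,0,0], fun x => ?_⟩; simp [e4]; done)
    | (refine ⟨![0,0,0,0,0,0,0,0,0,0,1,0,0,0,0], fun x => ?_⟩; simp [e4]; done)
    | (refine ⟨![0,0,0,0,0,0,0,0,0,0,0,1,0,0,0], fun x => ?_⟩; simp [e4]; done)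
    | (refine ⟨![0,0,0,0,0,0,0,0,0,0,0,0,1,0,0], fun x => ?_⟩; simp [e4]; done)
    | (refine ⟨![0,0,0,0,0,0,0,0,0,0,0,0,0,1,0], fun x => ?_⟩; simp [e4]; done)
    | (refine ⟨![0,0,0,0,0,0,0,0,0,0,0,0,0,0,1], fun x => ?_⟩; simp [e4]; done)

lemma exists_e4 (f : MvPolynomial (Fin 3) ℝ) (hhom : f.IsHomogeneous 4) :
    ∃ F : Fin 15 → ℝ, ∀ x, eval x f = e4 F x := by
  have h : ∀ d : Fin 3 →₀ ℕ, ∃ F : Fin 15 → ℝ, d ∈ f.support → ∀ x : Fin 3 → ℝ,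
      ∏ i, x i ^ d i = e4 F x := by
    intro d
    by_cases hd : d ∈ f.support
    · have h4 : d.degree = 4 := by
        by_contra hne
        exact (mem_support_iff.1 hd) (hhom.coeff_eq_zero hne)
      rw [Finsupp.degree_eq_sum, Fin.sum_univ_three] at h4
      obtain ⟨F, hF⟩ := monomial_e4 _ _ _ h4
      exact ⟨F, fun _ x => by rw [Fin.prod_univ_three, hF]⟩
    · exact ⟨0, fun h => absurd h hd⟩
  choose G hG using h
  refine ⟨∑ d ∈ f.support, f.coeff d • G d, fun x => ?_⟩
  rw [eval_eq', e4_sum]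
  refine Finset.sum_congr rfl fun d hd => ?_
  rw [e4_smul, hG d hd]

lemma hasDerivAt_eval_update (f : MvPolynomial (Fin 3) ℝ) (a : Fin 3 → ℝ) (i : Fin 3) (t : ℝ) :
    HasDerivAt (fun t => eval (Function.update a i t) f)
      (eval (Function.update a i t) (pderiv i f)) t := by
  induction f using MvPolynomial.induction_on with
  | C r => simpa using hasDerivAt_const t r
  | add p q hp hq => simpa only [map_add] using hp.fun_add hq
  | mul_X p j hp =>
    have hX : HasDerivAt (fun t => Function.update a i t j)
        (eval (Function.update a i t) (pderiv i (X j : MvPolynomial (Fin 3) ℝ))) t := by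
      by_cases hij : j = i
      · subst hij
        simpa using hasDerivAt_id' t
      · simpa [Function.update_of_ne hij, pderiv_X_of_ne hij] using hasDerivAt_const t (a j)
    have := hp.fun_mul hX
    simp only [Derivation.leibniz, smul_eq_mul, map_add, map_mul, eval_X]
    refine this.congr_deriv ?_
    rw [add_comm, mul_comm (Function.update a i t j)]

lemma eval_toC (f : MvPolynomial (Fin 3) ℝ) (a : Fin 3 → ℝ) :
    eval (toC a) (map (algebraMap ℝ ℂ) f) = ((eval a f : ℝ) : ℂ) := by
  rw [eval_map]
  exact (eval₂_comp_left (algebraMap ℝ ℂ) (RingHom.id ℝ) a f).symm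

lemma pd_of_smooth (f : MvPolynomial (Fin 3) ℝ) (hsm : IsSmooth f) (hpsd : IsPsd f)
    (a : Fin 3 → ℝ) (ha : a ≠ 0) : 0 < eval a f := by
  refine lt_of_le_of_ne (hpsd a) fun h0 => ha ?_
  have h := hsm (toC a) (fun i => by
    rw [pderiv_map, eval_toC]
    have hd := hasDerivAt_eval_update f a i (a i)
    have hm : IsLocalMin (fun t => eval (Function.update a i t) f) (a i) :=
      Filter.Eventually.of_forall fun t => by
        simp only [Function.update_eq_self]
        rw [← h0]; exact hpsd _
    have := hm.hasDerivAt_eq_zero hd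
    rw [Function.update_eq_self] at this
    rw [this]; simp)
  ext i
  have := congrFun h i
  simpa [toC] using this

/-- quadratic polynomial with given coefficients -/
noncomputable def quadPoly (p : Fin 6 → ℝ) : MvPolynomial (Fin 3) ℝ := ∑ j, C (p j) * gramBasis j

lemma eval_quadPoly (p : Fin 6 → ℝ) (x : Fin 3 → ℝ) : eval x (quadPoly p) = e2 p x := by
  simp [quadPoly, gramBasis, Fin.sum_univ_six, e2]

lemma eval_quadPoly_complex (p : Fin 6 → ℝ) (x : Fin 3 → ℂ) :
    eval x (map (algebraMap ℝ ℂ) (quadPoly p)) = e2 (toC p) x := by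
  simp [quadPoly, gramBasis, Fin.sum_univ_six, e2, toC]

lemma bpf_of_smooth (f : MvPolynomial (Fin 3) ℝ) (hsm : IsSmooth f) (p : Fin 3 → Fin 6 → ℝ)
    (h : ∀ x, eval x f = e4 (sos p) x) : BPF p := by
  have hf : f = ∑ k, quadPoly (p k) ^ 2 := by
    apply MvPolynomial.funext
    intro x
    rw [h, e4_sos]
    simp [eval_quadPoly]
  intro a ha
  apply hsm
  intro i
  rw [hf]
  simp only [map_sum, map_pow, Derivation.leibniz_pow, eval_quadPoly_complex]
  refine Finset.sum_eq_zero fun k _ => ?_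
  have hk := eval_quadPoly_complex (p k) a
  rw [ha k] at hk
  simp only [smul_eq_mul, map_nsmul, map_mul, map_pow, hk]
  simp

lemma gram_of_rows {ι : Type*} [Fintype ι] (f : MvPolynomial (Fin 3) ℝ)
    (A : ι → Fin 6 → ℝ) (hA : LinearIndependent ℝ A)
    (h : ∀ x, ∑ k, e2 (A k) x ^ 2 = eval x f) :
    ∃ G ∈ GramSpectrahedron f, G.rank = Fintype.card ι := by
  classical
  refine ⟨(Matrix.of A)ᵀ * Matrix.of A, ⟨?_, ?_⟩, ?_⟩
  · have := Matrix.posSemidef_conjTranspose_mul_self (Matrix.of A)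
    rwa [Matrix.conjTranspose_eq_transpose_of_trivial] at this
  · apply MvPolynomial.funext
    intro x
    rw [← h]
    have hq : ∀ k, e2 (A k) x = ∑ j, A k j * eval x (gramBasis j) := by
      intro k; rw [← eval_quadPoly]; simp [quadPoly]
    simp only [hq, pow_two, Finset.sum_mul_sum]
    simp only [map_sum, map_mul, eval_C, Matrix.mul_apply, Matrix.transpose_apply, Matrix.of_apply,
      Finset.sum_mul]
    conv_rhs => rw [Finset.sum_comm]
    refine Finset.sum_congr rfl fun i _ => ?_
    conv_rhs => rw [Finset.sum_comm]
    refine Finset.sum_congr rfl fun j _ => Finset.sum_congr rfl fun k _ => ?_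
    ring
  · rw [Matrix.rank_transpose_mul_self]
    exact LinearIndependent.rank_matrix hA

lemma BPF.perturb {p : Fin 3 → Fin 6 → ℝ} (hp : BPF p) {m : ℕ} (s : Fin m → Fin 6 → ℝ)
    (hs : LinearIndependent ℝ (Sum.elim p s)) :
    ∃ A : Fin 3 ⊕ Fin m → Fin 6 → ℝ, LinearIndependent ℝ A ∧
      ∀ x, ∑ k, e2 (A k) x ^ 2 = e4 (sos p) x := by
  have hU : {q : Fin 3 → Fin 6 → ℝ | LinearIndependent ℝ (Sum.elim q s)} ∈ nhds p := by
    have hc : Continuous (fun q : Fin 3 → Fin 6 → ℝ => (Sum.elim q s : Fin 3 ⊕ Fin m → Fin 6 → ℝ)) := by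
      apply continuous_pi
      rintro (i | j)
      · exact continuous_apply i
      · exact continuous_const
    exact (isOpen_setOfPred_linearIndependent.preimage hc).mem_nhds hs
  have hV := Filter.image_mem_map (m := sos) hU
  rw [hp.map_nhds] at hV
  set S : Fin 15 → ℝ := ∑ j, m22 (s j) (s j) with hS
  have hc : Continuous (fun ε : ℝ => sos p - ε • S) := by fun_prop
  have h1 := hc.continuousAt.preimage_mem_nhds (x := (0 : ℝ)) (by simpa using hV)
  have h2 : ∀ᶠ ε in nhdsWithin (0 : ℝ) (Set.Ioi 0), ε ∈ (fun ε => sos p - ε • S) ⁻¹' (sos ''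
      {q | LinearIndependent ℝ (Sum.elim q s)}) := mem_nhdsWithin_of_mem_nhds h1
  obtain ⟨ε, ⟨q, hq, hqe⟩, hε⟩ := (h2.and self_mem_nhdsWithin).exists
  have hε' : 0 < Real.sqrt ε := Real.sqrt_pos.2 hε
  refine ⟨Sum.elim q (fun j => Real.sqrt ε • s j), ?_, fun x => ?_⟩
  · have := LinearIndependent.units_smul hq
      (Sum.elim (fun _ => 1) (fun _ => Units.mk0 (Real.sqrt ε) hε'.ne'))
    convert this using 1
    ext1 k
    rcases k with k | k
    · simp
    · simp [Units.smul_def]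
  · have h3 : sos p = sos q + ε • S := by
      rw [hqe]; simp
    rw [h3, e4_add, e4_smul, hS, e4_sum, e4_sos, Fintype.sum_sum_type]
    simp only [Sum.elim_inl, Sum.elim_inr, e4_m22, Finset.mul_sum]
    congr 1
    refine Finset.sum_congr rfl fun j _ => ?_
    have h5 : e2 (Real.sqrt ε • s j) x = Real.sqrt ε * e2 (s j) x := by
      simp [e2]; ring
    rw [h5, mul_pow, Real.sq_sqrt (le_of_lt hε)]; ring

lemma extend_family {p : Fin 3 → Fin 6 → ℝ} (hp : LinearIndependent ℝ p) (m : ℕ) (hm : m ≤ 3) :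
    ∃ s : Fin m → Fin 6 → ℝ, LinearIndependent ℝ (Sum.elim p s) := by
  obtain ⟨W', hW⟩ := Submodule.exists_isCompl (Submodule.span ℝ (Set.range p))
  have h1 := Submodule.finrank_add_eq_of_isCompl hW
  rw [finrank_span_eq_card hp] at h1
  simp only [Module.finrank_pi, Fintype.card_fin] at h1
  have h3 : Module.finrank ℝ W' = 3 := by omega
  let b := Module.finBasisOfFinrankEq ℝ W' h3
  refine ⟨fun j => (b (Fin.castLE hm j) : Fin 6 → ℝ), ?_⟩
  refine LinearIndependent.sum_type hp ?_ ?_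
  · have hb := (b.linearIndependent.comp (Fin.castLE hm) (Fin.castLE_injective hm)).map'
      W'.subtype (Submodule.ker_subtype W')
    exact hb
  · refine hW.disjoint.mono_right ?_
    rw [Submodule.span_le]
    rintro _ ⟨j, rfl⟩
    exact (b (Fin.castLE hm j)).2

/-- The Gram spectrahedron of a smooth psd ternary quartic contains matrices of all
ranks in the Pataki interval `{3, 4, 5}`. -/
theorem all_pataki_ranks_attained
    (f : MvPolynomial (Fin 3) ℝ) (hhom : f.IsHomogeneous 4)
    (hsm : IsSmooth f) (hpsd : IsPsd f) :
    ∀ r ∈ ({3, 4, 5} : Set ℕ), ∃ G ∈ GramSpectrahedron f, G.rank = r := by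
  obtain ⟨F, hF⟩ := exists_e4 f hhom
  have hpd : PD F := fun x hx => by
    rw [← hF]; exact pd_of_smooth f hsm hpsd x hx
  obtain ⟨p, rfl⟩ := hilbert hpd
  have hp := bpf_of_smooth f hsm p hF
  have key : ∀ m ≤ 3, ∃ G ∈ GramSpectrahedron f, G.rank = 3 + m := by
    intro m hm
    obtain ⟨s, hs⟩ := extend_family hp.linearIndependent m hm
    obtain ⟨A, hA, hAs⟩ := hp.perturb s hs
    obtain ⟨G, hG, hr⟩ := gram_of_rows f A hA (fun x => by rw [hAs, hF])
    exact ⟨G, hG, by simpa using hr⟩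
  rintro r (rfl | rfl | rfl)
  · exact key 0 (by norm_num)
  · exact key 1 (by norm_num)
  · exact key 2 (by norm_num)
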